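/- There exists a covering map f of the open annulus A = (ℝ/ℤ) × (0,1) of degree 2 (i.e. f : A → A is a covering map and some lift F : ℝ × (0,1) → ℝ × (0,1) satisfies F(x+1,y) = F(x,y) + (2,0)) that is not semiconjugate to the circle map m₂ : z ↦ 2z: there is no continuous map h : A → ℝ/ℤ of degree one (i.e. admitting a continuous lift H : ℝ × (0,1) → ℝ with H(x+1,y) = H(x,y) + 1 and h(p(v)) = H(v) + ℤ) such that h ∘ f = m₂ ∘ h. -/

import Mathlib

noncomputable section

/-- The open annulus `A = (ℝ/ℤ) × (0,1)`. -/
abbrev OpenAnnulus := AddCircle (1 : ℝ) × Set.Ioo (0 : ℝ) 1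

/-- The universal cover `ℝ × (0,1)` of the open annulus. -/
abbrev Strip := ℝ × Set.Ioo (0 : ℝ) 1

/-- The universal covering projection `p : ℝ × (0,1) → A`. -/
def annulusProj : Strip → OpenAnnulus := fun v => ((v.1 : AddCircle (1 : ℝ)), v.2)

/-- The deck transformation `v ↦ v + (1,0)` of the strip. -/
def shift (v : Strip) : Strip := (v.1 + 1, v.2)

open Filter Topology

section Covering

variable {X Y Z : Type*} [TopologicalSpace X] [TopologicalSpace Y] [TopologicalSpace Z]

theorem IsEvenlyCovered.prodMap_id {I : Type*} [TopologicalSpace I] {f : X → Y} {y : Y}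
    (h : IsEvenlyCovered f y I) (z : Z) :
    IsEvenlyCovered (Prod.map f (id : Z → Z)) (y, z) I := by
  obtain ⟨hI, U, hyU, hU, hfU, H, hH⟩ := h
  refine ⟨hI, Prod.fst ⁻¹' U, hyU, hU.preimage continuous_fst, hfU.preimage continuous_fst,
    { toFun := fun x => (⟨((H ⟨x.1.1, x.2⟩).1, x.1.2), (H ⟨x.1.1, x.2⟩).1.2⟩, (H ⟨x.1.1, x.2⟩).2)
      invFun := fun w => ⟨(H.symm (⟨w.1.1.1, w.1.2⟩, w.2), w.1.1.2),
        (H.symm (⟨w.1.1.1, w.1.2⟩, w.2)).2⟩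
      left_inv := fun x => by simp
      right_inv := fun w => by simp
      continuous_toFun := by fun_prop
      continuous_invFun := by fun_prop }, fun x => ?_⟩
  exact Prod.ext (hH ⟨x.1.1, x.2⟩) rfl

theorem IsCoveringMap.prodMap_id {f : X → Y} (hf : IsCoveringMap f) :
    IsCoveringMap (Prod.map f (id : Z → Z)) :=
  fun x => ((hf x.1).prodMap_id x.2).to_isEvenlyCovered_preimage

end Covering

/-- The logit homeomorphism between the open unit interval and the real line. -/
def logitHomeomorph : Set.Ioo (0 : ℝ) 1 ≃ₜ ℝ :=
  ((Real.sigmoid_strictMono.orderIso Real.sigmoid).trans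
    (OrderIso.setCongr _ _ Real.range_sigmoid)).symm.toHomeomorph

/-- The amount by which heights move over the point `x`: it is `1` near the fixed point `0` of
angle doubling and `-1` near its orbit of period two `{1/3, 2/3}`. -/
def drift (x : ℝ) : ℝ := max (-1) (min 1 (2 * Real.cos (2 * Real.pi * x)))

theorem continuous_drift : Continuous drift := by unfold drift; fun_prop

theorem drift_periodic : Function.Periodic drift 1 := fun x => by
  simp [drift, mul_add, Real.cos_add_two_pi]

theorem drift_eq_one {x : ℝ} (h0 : 0 ≤ x) (h1 : x ≤ 1 / 6) : drift x = 1 := by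
  have h : Real.cos (Real.pi / 3) ≤ Real.cos (2 * Real.pi * x) :=
    Real.cos_le_cos_of_nonneg_of_le_pi (by positivity) (by linarith [Real.pi_pos])
      (by nlinarith [Real.pi_pos])
  rw [Real.cos_pi_div_three] at h
  rw [drift, min_eq_left (by linarith), max_eq_right (by norm_num)]

theorem cos_two_pi_mul_two_pow_div_three (k : ℕ) :
    Real.cos (2 * Real.pi * (2 ^ k / 3)) = -1 / 2 := by
  induction k with
  | zero =>
    rw [show 2 * Real.pi * (2 ^ 0 / 3) = 2 * (Real.pi / 3) by ring, Real.cos_two_mul,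
      Real.cos_pi_div_three]
    norm_num
  | succ k ih =>
    rw [show 2 * Real.pi * (2 ^ (k + 1) / 3) = 2 * (2 * Real.pi * (2 ^ k / 3)) by ring,
      Real.cos_two_mul, ih]
    norm_num

theorem drift_two_pow_div_three (k : ℕ) : drift (2 ^ k / 3) = -1 := by
  rw [drift, cos_two_pi_mul_two_pow_div_three]
  norm_num

/-- The function induced by `drift` on the circle. -/
def circleDrift : AddCircle (1 : ℝ) → ℝ := drift_periodic.lift

@[simp] theorem circleDrift_coe (x : ℝ) : circleDrift x = drift x :=
  drift_periodic.lift_coe x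

@[fun_prop] theorem continuous_circleDrift : Continuous circleDrift :=
  continuous_coinduced_dom.mpr continuous_drift

/-- The homeomorphism of the annulus moving heights by `circleDrift`. -/
def verticalHomeomorph : OpenAnnulus ≃ₜ OpenAnnulus where
  toFun a := (a.1, logitHomeomorph.symm (logitHomeomorph a.2 + circleDrift a.1))
  invFun a := (a.1, logitHomeomorph.symm (logitHomeomorph a.2 - circleDrift a.1))
  left_inv a := by simp
  right_inv a := by simp
  continuous_toFun := by fun_prop
  continuous_invFun := by fun_prop

/-- The rotation angle at a given height; it is an integer at each natural height. -/
def spin (t : ℝ) : ℝ := (4 : ℝ) ^ t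

@[fun_prop] theorem continuous_spin : Continuous spin :=
  Real.continuous_const_rpow (by norm_num)

theorem spin_natCast (n : ℕ) : spin n = ((4 ^ n : ℕ) : ℝ) := by simp [spin]

/-- The homeomorphism of the annulus rotating each circle by the `spin` of its height. -/
def spinHomeomorph : OpenAnnulus ≃ₜ OpenAnnulus where
  toFun a := (a.1 + (spin (logitHomeomorph a.2) : ℝ), a.2)
  invFun a := (a.1 - (spin (logitHomeomorph a.2) : ℝ), a.2)
  left_inv a := by simp
  right_inv a := by simp
  continuous_toFun := by
    have := AddCircle.continuous_mk' (1 : ℝ)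
    fun_prop
  continuous_invFun := by
    have := AddCircle.continuous_mk' (1 : ℝ)
    fun_prop

/-- A degree-two covering of the annulus whose orbits near the upper end spin arbitrarily fast. -/
def spinningCover : OpenAnnulus → OpenAnnulus :=
  spinHomeomorph ∘ Prod.map (fun z => (2 : ℤ) • z) id ∘ verticalHomeomorph

theorem isCoveringMap_spinningCover : IsCoveringMap spinningCover :=
  ((AddCircle.isAddQuotientCoveringMap_zsmul_of_ne_zero (1 : ℝ) 2).isCoveringMap.prodMap_id
    |>.comp_homeomorph verticalHomeomorph).homeomorph_comp spinHomeomorph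

theorem surjective_spinningCover : Function.Surjective spinningCover :=
  spinHomeomorph.surjective.comp <|
    ((AddCircle.isAddQuotientCoveringMap_zsmul_of_ne_zero (1 : ℝ) 2).surjective.prodMap
      Function.surjective_id).comp verticalHomeomorph.surjective

/-- The lift of `spinningCover` to the strip. -/
def spinningLift (v : Strip) : Strip :=
  (2 * v.1 + spin (logitHomeomorph v.2 + drift v.1),
    logitHomeomorph.symm (logitHomeomorph v.2 + drift v.1))

theorem continuous_spinningLift : Continuous spinningLift := by
  have := continuous_drift
  unfold spinningLift
  fun_prop

theorem annulusProj_spinningLift (v : Strip) :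
    annulusProj (spinningLift v) = spinningCover (annulusProj v) := by
  simp [annulusProj, spinningLift, spinningCover, spinHomeomorph, verticalHomeomorph, two_mul,
    two_zsmul]

theorem spinningLift_shift (v : Strip) :
    spinningLift (shift v) = ((spinningLift v).1 + 2, (spinningLift v).2) := by
  simp only [spinningLift, shift, drift_periodic v.1]
  ext <;> simp
  ring

/-- A continuous function on the plane that commutes with the unit horizontal translation cannot
conjugate the spinning map to doubling. -/
theorem not_semiconj_two_mul {K : ℝ → ℝ → ℝ} (hK : Continuous (fun x => K x 0))
    (hshift : ∀ x t, K (x + 1) t = K x t + 1)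
    (hsemi : ∀ x t, K (2 * x + spin (t + drift x)) (t + drift x) = 2 * K x t) : False := by
  have hnat : ∀ (m : ℕ) (x t : ℝ), K (x + m) t = K x t + m := by
    intro m x t
    induction m with
    | zero => simp
    | succ m ih => push_cast; rw [← add_assoc, hshift, ih]; ring
  obtain ⟨C, hC⟩ : ∃ C, ∀ x, x - C ≤ K x 0 := by
    have hper : Function.Periodic (fun x => K x 0 - x) 1 := fun x => by
      simp only [hshift]; ring
    obtain ⟨C, hC⟩ := (isCompact_Icc (a := (0 : ℝ)) (b := 1)).exists_bound_of_continuousOn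
      (f := fun x => K x 0 - x) (by fun_prop)
    refine ⟨C, fun x => ?_⟩
    obtain ⟨y, hy, hxy⟩ := hper.exists_mem_Ico₀ one_pos x
    have := (abs_le.mp (hC y (Set.Ico_subset_Icc_self hy))).1
    linarith
  have hdown : ∀ m k : ℕ, K (2 ^ (k + m) / 3) 0 ≤ 2 ^ m * K (2 ^ k / 3) m := by
    intro m
    induction m with
    | zero => intro k; simp
    | succ m ih =>
      intro k
      have h := hsemi (2 ^ k / 3) (m + 1 : ℕ)
      rw [drift_two_pow_div_three, show ((m + 1 : ℕ) : ℝ) + -1 = m by push_cast; ring,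
        spin_natCast, hnat, show (2 : ℝ) * (2 ^ k / 3) = 2 ^ (k + 1) / 3 by ring] at h
      have h' := ih (k + 1)
      rw [show k + 1 + m = k + (m + 1) by ring] at h'
      have h4 : (0 : ℝ) ≤ ((4 ^ m : ℕ) : ℝ) := Nat.cast_nonneg _
      calc _ ≤ _ := h'
        _ ≤ 2 ^ m * (2 * K (2 ^ k / 3) (m + 1 : ℕ)) := by gcongr; linarith
        _ = _ := by ring
  have hup : ∀ i k : ℕ,
      K (2 ^ i * (1 / (3 * 2 ^ (i + k)))) i + 4 ^ i - 1 ≤ 2 ^ i * K (1 / (3 * 2 ^ (i + k))) 0 := by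
    intro i
    induction i with
    | zero => intro k; simp
    | succ i ih =>
      intro k
      have h := ih (k + 1)
      rw [show i + (k + 1) = i + 1 + k by ring] at h
      have hx : (2 : ℝ) ^ i * (1 / (3 * 2 ^ (i + 1 + k))) ≤ 1 / 6 := by
        have h1 : (1 : ℝ) ≤ 2 ^ k := one_le_pow₀ (by norm_num)
        rw [pow_add, pow_add, mul_one_div, div_le_div_iff₀ (by positivity) (by norm_num)]
        nlinarith [pow_pos (two_pos : (0 : ℝ) < 2) i]
      have h' := hsemi (2 ^ i * (1 / (3 * 2 ^ (i + 1 + k)))) i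
      rw [drift_eq_one (by positivity) hx, ← Nat.cast_add_one, spin_natCast, hnat, ← mul_assoc,
        ← pow_succ'] at h'
      push_cast at h' ⊢
      have h1 : (1 : ℝ) ≤ 4 ^ i := one_le_pow₀ (by norm_num)
      rw [pow_succ 2 i] at h' ⊢
      linarith
  have hlower : ∀ n : ℕ, (2 : ℝ) ^ n - 1 - |C| ≤ K (1 / (3 * 2 ^ n)) 0 := by
    intro n
    have h1 := hup n 0
    have h2 := hdown n 0
    have h3 := hC (2 ^ n / 3)
    have h2n : (1 : ℝ) ≤ 2 ^ n := one_le_pow₀ (by norm_num)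
    have hpos : (0 : ℝ) < 2 ^ n := by positivity
    rw [add_zero, show (2 : ℝ) ^ n * (1 / (3 * 2 ^ n)) = 1 / 3 by field_simp] at h1
    rw [zero_add, pow_zero] at h2
    have h4 : -|C| ≤ K (1 / 3) n := by
      by_contra! hlt
      nlinarith [le_abs_self C, abs_nonneg C]
    have h5 : (4 : ℝ) ^ n = 2 ^ n * 2 ^ n := by rw [← mul_pow]; norm_num
    refine le_of_mul_le_mul_left ?_ hpos
    nlinarith [abs_nonneg C]
  have hlim : Tendsto (fun n : ℕ => 1 / (3 * (2 : ℝ) ^ n)) atTop (𝓝 0) := by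
    simp only [one_div]
    exact ((tendsto_pow_atTop_atTop_of_one_lt one_lt_two).const_mul_atTop
      three_pos).inv_tendsto_atTop
  refine not_tendsto_nhds_of_tendsto_atTop (tendsto_atTop_mono hlower ?_) _
    ((hK.tendsto 0).comp hlim)
  simp only [sub_eq_add_neg]
  exact tendsto_atTop_add_const_right _ _ <| tendsto_atTop_add_const_right _ _ <|
    tendsto_pow_atTop_atTop_of_one_lt one_lt_two

/-- there exists a degree-2 covering map `f` of the open annulus
that is not semiconjugate to the circle map `m₂ : z ↦ 2z` by any continuous
degree-one map `h : A → ℝ/ℤ`. -/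
theorem exists_covering_not_semiconjugate :
    ∃ (f : OpenAnnulus → OpenAnnulus) (F : Strip → Strip),
      IsCoveringMap f ∧ Function.Surjective f ∧
      Continuous F ∧
      (∀ v : Strip, annulusProj (F v) = f (annulusProj v)) ∧
      (∀ v : Strip, F (shift v) = ((F v).1 + 2, (F v).2)) ∧
      ¬ ∃ (h : OpenAnnulus → AddCircle (1 : ℝ)) (H : Strip → ℝ),
          Continuous h ∧
          (∀ a : OpenAnnulus, h (f a) = (2 : ℤ) • h a) ∧
          Continuous H ∧
          (∀ v : Strip, H (shift v) = H v + 1) ∧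
          (∀ v : Strip, h (annulusProj v) = (H v : AddCircle (1 : ℝ))) := by
  refine ⟨spinningCover, spinningLift, isCoveringMap_spinningCover, surjective_spinningCover,
    continuous_spinningLift, annulusProj_spinningLift, spinningLift_shift, ?_⟩
  rintro ⟨h, H, -, hsemi, hH, hshift, hlift⟩
  have hdefect : ∀ v : Strip, ((H (spinningLift v) - 2 * H v : ℝ) : AddCircle (1 : ℝ)) = 0 := by
    intro v
    have := hsemi (annulusProj v)
    rw [← annulusProj_spinningLift, hlift, hlift] at this
    rw [two_mul, AddCircle.coe_sub, this, AddCircle.coe_add, two_zsmul, sub_self]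
  have : PreconnectedSpace (Set.Ioo (0 : ℝ) 1) :=
    Subtype.preconnectedSpace isPreconnected_Ioo
  have hcont : Continuous fun v => H (spinningLift v) - 2 * H v :=
    (hH.comp continuous_spinningLift).sub (hH.const_mul 2)
  have hconst := (AddCircle.isCoveringMap_coe (1 : ℝ)).const_of_comp hcont
    fun v w => (hdefect v).trans (hdefect w).symm
  let k := H (spinningLift (0, logitHomeomorph.symm 0)) - 2 * H (0, logitHomeomorph.symm 0)
  refine not_semiconj_two_mul (K := fun x t => H (x, logitHomeomorph.symm t) + k)
    (by fun_prop) (fun x t => ?_) fun x t => ?_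
  · have := hshift (x, logitHomeomorph.symm t)
    rw [shift] at this
    simp only [this]
    ring
  · have := hconst (x, logitHomeomorph.symm t) (0, logitHomeomorph.symm 0)
    change _ = k at this
    simp only [spinningLift, Homeomorph.apply_symm_apply] at this
    linarith

end
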